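/- Let d ≥ 3 and f ∈ ℛ_d. Assume that M_f contains a nonzero nilpotent matrix A ∈ Mat_r(K), and let n = index(A) − 1 ≥ 1, where index(A) = min{k ≥ 1 : A^k = 0}. Then there exists f_t ∈ ℛ_d ⊗_K K[t_1,…,t_n] such that f_0 = f (evaluation at t_1 = … = t_n = 0) and f_t splits regularly n times over K(t_1,…,t_n). -/

import Mathlib

open MvPolynomial

namespace Kleppe

noncomputable section

open scoped Classical

variable {K : Type*}

/-- The iterated partial-derivative operator `∂^β` applied to `f`
(in the standard polynomial ring; char 0 identification of divided powers). -/
def derivMulti [CommSemiring K] {r : ℕ} (β : Fin r →₀ ℕ) (f : MvPolynomial (Fin r) K) :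
    MvPolynomial (Fin r) K :=
  ∑ α ∈ f.support,
    if β ≤ α then
      MvPolynomial.monomial (α - β)
        ((∏ i : Fin r, (α i).descFactorial (β i)) • MvPolynomial.coeff α f)
    else 0

/-- The apolarity action `D(f)` of a differential operator `D ∈ R = K[∂_1,…,∂_r]`
on a polynomial `f ∈ ℛ = K[x_1,…,x_r]`; `∂_i` acts as `∂/∂x_i`. -/
def contract [CommSemiring K] {r : ℕ} (D f : MvPolynomial (Fin r) K) :
    MvPolynomial (Fin r) K :=
  ∑ β ∈ D.support, MvPolynomial.coeff β D • derivMulti β f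

/-- `(A∂)_i = Σ_k A_{ik} ∂_k`, as an element of `R`. -/
def rowOp [CommSemiring K] {r : ℕ} (A : Matrix (Fin r) (Fin r) K) (i : Fin r) :
    MvPolynomial (Fin r) K :=
  ∑ k : Fin r, A i k • X k

/-- The matrix space `M_f = {A | ∂_i·(A∂)_j − ∂_j·(A∂)_i ∈ ann_R f for all i,j}`. -/
def Mf [CommRing K] {r : ℕ} (f : MvPolynomial (Fin r) K) :
    Set (Matrix (Fin r) (Fin r) K) :=
  {A | ∀ i j : Fin r, contract (X i * rowOp A j - X j * rowOp A i) f = 0}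

/-- `γ_f(A)`: the unique homogeneous `g` of degree `d` with `∂_i g = (A∂)_i (f)` for all `i`
(defined by choice; junk value `0` if no such `g` exists). -/
def gammaf [CommRing K] {r : ℕ} (d : ℕ) (f : MvPolynomial (Fin r) K)
    (A : Matrix (Fin r) (Fin r) K) : MvPolynomial (Fin r) K :=
  if h : ∃ g : MvPolynomial (Fin r) K, g.IsHomogeneous d ∧
      ∀ i, contract (X i) g = contract (rowOp A i) f then h.choose else 0

/-- `R_e(g)`, the space of contractions of `g` by homogeneous operators of degree `e`. -/
def partials [CommRing K] {r : ℕ} (e : ℕ) (g : MvPolynomial (Fin r) K) :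
    Submodule K (MvPolynomial (Fin r) K) :=
  Submodule.span K {p | ∃ D : MvPolynomial (Fin r) K, D.IsHomogeneous e ∧ p = contract D g}

/-- `G` is (the set of components of) a regular splitting of `f`:
`f = Σ_{g ∈ G} g`, each `g` a nonzero degree-`d` form, and the spaces of
`(d−1)`-st partials `R_{d−1}(g)` are independent. -/
def IsRegSplit [CommRing K] {r : ℕ} (d : ℕ) (f : MvPolynomial (Fin r) K)
    (G : Set (MvPolynomial (Fin r) K)) : Prop :=
  G.Finite ∧ G.Nonempty ∧ (∀ g ∈ G, g ≠ 0 ∧ g.IsHomogeneous d) ∧ (∑ᶠ g ∈ G, g) = f ∧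
  ∀ g ∈ G, Disjoint (partials (d - 1) g) (⨆ h ∈ G \ {g}, partials (d - 1) h)

/-- A complete set of orthogonal idempotents in `M_f`. -/
def IsCoid [CommRing K] {r : ℕ} (f : MvPolynomial (Fin r) K)
    (E : Set (Matrix (Fin r) (Fin r) K)) : Prop :=
  E.Finite ∧ E ⊆ Mf f ∧ (∀ A ∈ E, A ≠ 0) ∧
  (∀ A ∈ E, ∀ B ∈ E, A ≠ B → A * B = 0) ∧ (∑ᶠ A ∈ E, A) = 1

end

section contractLemmas

theorem coeff_derivMulti {K : Type*} [CommSemiring K] {r : ℕ} (β γ : Fin r →₀ ℕ)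
    (f : MvPolynomial (Fin r) K) :
    coeff γ (derivMulti β f) =
      (∏ i : Fin r, ((γ + β) i).descFactorial (β i) : ℕ) * coeff (γ + β) f := by
  classical
  unfold derivMulti
  rw [coeff_sum]
  rw [Finset.sum_eq_single (γ + β)]
  · rw [if_pos (by simp)]
    simp [nsmul_eq_mul]
  · intro α _ hα
    split_ifs with h
    · rw [coeff_monomial, if_neg]
      intro h2
      apply hα
      rw [← h2, tsub_add_cancel_of_le h]
    · simp
  · intro h
    rw [notMem_support_iff] at h
    rw [h]
    simp

theorem coeff_pderiv' {K : Type*} [CommSemiring K] {r : ℕ} (i : Fin r) (γ : Fin r →₀ ℕ)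
    (f : MvPolynomial (Fin r) K) :
    coeff γ (pderiv i f) = coeff (γ + Finsupp.single i 1) f * ((γ i : ℕ) + 1 : ℕ) := by
  classical
  induction f using MvPolynomial.induction_on' with
  | add p q hp hq => simp [hp, hq, add_mul]
  | monomial u a =>
    rw [pderiv_monomial, coeff_monomial, coeff_monomial]
    by_cases h : u = γ + Finsupp.single i 1
    · subst h
      simp
    · rw [if_neg h]
      split_ifs with h2
      · by_cases hu : u i = 0
        · simp [hu]
        · exfalso; apply h
          rw [← h2, tsub_add_cancel_of_le]
          simp; omega
      · simp

theorem derivMulti_zero {K : Type*} [CommSemiring K] {r : ℕ}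
    (f : MvPolynomial (Fin r) K) : derivMulti 0 f = f := by
  ext γ
  rw [coeff_derivMulti]
  simp

theorem derivMulti_single_add {K : Type*} [CommSemiring K] {r : ℕ} (i : Fin r) (β : Fin r →₀ ℕ)
    (f : MvPolynomial (Fin r) K) :
    derivMulti (Finsupp.single i 1 + β) f = pderiv i (derivMulti β f) := by
  classical
  ext γ
  rw [coeff_pderiv', coeff_derivMulti, coeff_derivMulti]
  rw [← add_assoc, mul_right_comm, ← Nat.cast_mul]
  congr 2
  rw [← Finset.prod_erase_mul _ _ (Finset.mem_univ i), ← Finset.prod_erase_mul (Finset.univ) _ (Finset.mem_univ i), mul_assoc]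
  congr 1
  · apply Finset.prod_congr rfl
    intro j hj
    have : i ≠ j := (Finset.ne_of_mem_erase hj).symm
    simp [this]
  · simp only [Finsupp.add_apply, Finsupp.single_eq_same]
    rw [add_comm 1 (β i), Nat.descFactorial_succ, mul_comm]
    congr 1
    omega

theorem contract_eq_sum {K : Type*} [CommSemiring K] {r : ℕ} (D f : MvPolynomial (Fin r) K)
    (s : Finset (Fin r →₀ ℕ)) (hs : D.support ⊆ s) :
    contract D f = ∑ β ∈ s, coeff β D • derivMulti β f := by
  unfold contract
  apply Finset.sum_subset hs
  intro x _ hx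
  rw [notMem_support_iff] at hx
  simp [hx]

theorem contract_add {K : Type*} [CommSemiring K] {r : ℕ} (D E f : MvPolynomial (Fin r) K) :
    contract (D + E) f = contract D f + contract E f := by
  classical
  rw [contract_eq_sum (D + E) f (D.support ∪ E.support) support_add,
    contract_eq_sum D f (D.support ∪ E.support) Finset.subset_union_left,
    contract_eq_sum E f (D.support ∪ E.support) Finset.subset_union_right,
    ← Finset.sum_add_distrib]
  simp [add_smul]

theorem contract_monomial {K : Type*} [CommSemiring K] {r : ℕ} (β : Fin r →₀ ℕ) (a : K)
    (f : MvPolynomial (Fin r) K) :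
    contract (monomial β a) f = a • derivMulti β f := by
  classical
  rw [contract_eq_sum _ f {β} support_monomial_subset]
  simp

theorem contract_C {K : Type*} [CommSemiring K] {r : ℕ} (a : K)
    (f : MvPolynomial (Fin r) K) :
    contract (C a) f = a • f := by
  rw [C_apply, contract_monomial, derivMulti_zero]

theorem contract_X_mul {K : Type*} [CommSemiring K] {r : ℕ} (i : Fin r)
    (D f : MvPolynomial (Fin r) K) :
    contract (X i * D) f = pderiv i (contract D f) := by
  induction D using MvPolynomial.induction_on' with
  | add p q hp hq => rw [mul_add, contract_add, hp, hq, contract_add, map_add]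
  | monomial u a =>
    rw [X, monomial_mul, one_mul, contract_monomial, contract_monomial, derivMulti_single_add]
    simp

theorem contract_C_mul {K : Type*} [CommSemiring K] {r : ℕ} (a : K)
    (D f : MvPolynomial (Fin r) K) :
    contract (C a * D) f = a • contract D f := by
  induction D using MvPolynomial.induction_on' with
  | add p q hp hq => rw [mul_add, contract_add, hp, hq, contract_add, smul_add]
  | monomial u b =>
    rw [C_mul_monomial, contract_monomial, contract_monomial, mul_smul]

theorem contract_mul {K : Type*} [CommSemiring K] {r : ℕ}
    (D E f : MvPolynomial (Fin r) K) :
    contract (D * E) f = contract D (contract E f) := by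
  induction D using MvPolynomial.induction_on generalizing E f with
  | C a => rw [contract_C_mul, contract_C]
  | add p q hp hq => rw [add_mul, contract_add, hp, hq, contract_add]
  | mul_X p i hp => rw [mul_assoc, hp, contract_X_mul, hp]; rw [← mul_one (X i), contract_X_mul, ← C_1, contract_C, one_smul]

theorem contract_X {K : Type*} [CommSemiring K] {r : ℕ} (i : Fin r)
    (f : MvPolynomial (Fin r) K) :
    contract (X i) f = pderiv i f := by
  rw [← mul_one (X i), contract_X_mul, ← C_1, contract_C, one_smul]

theorem contract_smul_left {K : Type*} [CommSemiring K] {r : ℕ} (a : K)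
    (D f : MvPolynomial (Fin r) K) :
    contract (a • D) f = a • contract D f := by
  rw [smul_eq_C_mul, contract_C_mul]

theorem contract_zero_right {K : Type*} [CommSemiring K] {r : ℕ}
    (D : MvPolynomial (Fin r) K) : contract D 0 = 0 := by
  simp [contract, derivMulti]

theorem contract_zero_left {K : Type*} [CommSemiring K] {r : ℕ}
    (D : MvPolynomial (Fin r) K) : contract 0 D = 0 := by
  simp [contract]

theorem contract_sum {K : Type*} [CommSemiring K] {r : ℕ} {ι : Type*} (s : Finset ι)
    (D : ι → MvPolynomial (Fin r) K) (f : MvPolynomial (Fin r) K) :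
    contract (∑ i ∈ s, D i) f = ∑ i ∈ s, contract (D i) f := by
  classical
  induction s using Finset.induction_on with
  | empty => simp [contract_zero_left]
  | insert a s ha ih => rw [Finset.sum_insert ha, Finset.sum_insert ha, contract_add, ih]

theorem contract_add_right {K : Type*} [CommSemiring K] {r : ℕ} (D f g : MvPolynomial (Fin r) K) :
    contract D (f + g) = contract D f + contract D g := by
  unfold contract
  rw [← Finset.sum_add_distrib]
  refine Finset.sum_congr rfl fun β _ => ?_
  rw [← smul_add]
  congr 1
  ext γ
  simp [coeff_derivMulti, mul_add]

/-- the annihilator ideal -/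
def annIdeal {K : Type*} [CommRing K] {r : ℕ} (f : MvPolynomial (Fin r) K) :
    Ideal (MvPolynomial (Fin r) K) where
  carrier := {D | contract D f = 0}
  add_mem' := by
    intro a b ha hb
    simp only [Set.mem_ofPred_eq] at *
    rw [contract_add, ha, hb, add_zero]
  zero_mem' := contract_zero_left f
  smul_mem' := by
    intro c x hx
    simp only [Set.mem_ofPred_eq, smul_eq_mul] at *
    rw [contract_mul, hx, contract_zero_right]

theorem mk_eq_contract {K : Type*} [CommRing K] {r : ℕ} {f D E : MvPolynomial (Fin r) K}
    (h : Ideal.Quotient.mk (annIdeal f) D = Ideal.Quotient.mk (annIdeal f) E) :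
    contract D f = contract E f := by
  rw [Ideal.Quotient.eq] at h
  have h2 : contract (D - E) f = 0 := h
  have := contract_add (D - E) E f
  rw [h2] at this
  simpa using this

/-- linear form attached to a vector -/
noncomputable def lin {K : Type*} [CommSemiring K] {r : ℕ} :
    (Fin r → K) →ₗ[K] MvPolynomial (Fin r) K where
  toFun v := ∑ i, v i • X i
  map_add' := by intro u v; simp [add_smul, Finset.sum_add_distrib]
  map_smul' := by intro u v; simp [mul_smul, Finset.smul_sum]

theorem lin_apply {K : Type*} [CommSemiring K] {r : ℕ} (v : Fin r → K) :
    lin v = ∑ i, v i • (X i : MvPolynomial (Fin r) K) := rfl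

theorem lin_homog {K : Type*} [CommSemiring K] {r : ℕ} (v : Fin r → K) :
    (lin v).IsHomogeneous 1 := by
  rw [lin_apply]
  apply IsHomogeneous.sum
  intro i _
  rw [smul_eq_C_mul]
  exact IsHomogeneous.C_mul (isHomogeneous_X _ _) _

theorem contract_lin {K : Type*} [CommSemiring K] {r : ℕ} (v : Fin r → K)
    (f : MvPolynomial (Fin r) K) : contract (lin v) f = ∑ i, v i • pderiv i f := by
  rw [lin_apply, contract_sum]
  simp [contract_smul_left, contract_X]

theorem contract_lin_lin {K : Type*} [CommSemiring K] {r : ℕ} (u v : Fin r → K) :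
    contract (lin u) (lin v) = C (u ⬝ᵥ v) := by
  classical
  rw [contract_lin]
  simp only [lin_apply, map_sum, Derivation.map_smul, pderiv_X]
  simp [Pi.single_apply, dotProduct, smul_eq_C_mul]

theorem pderiv_homog {K : Type*} [CommSemiring K] {r d : ℕ} (i : Fin r)
    {f : MvPolynomial (Fin r) K} (hf : f.IsHomogeneous (d + 1)) :
    (pderiv i f).IsHomogeneous d := by
  intro γ hγ
  rw [coeff_pderiv'] at hγ
  have h := hf (left_ne_zero_of_mul hγ)
  rw [map_add, Finsupp.weight_single] at h
  simpa using h

theorem contract_lin_homog {K : Type*} [CommSemiring K] {r d : ℕ} (v : Fin r → K)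
    {f : MvPolynomial (Fin r) K} (hf : f.IsHomogeneous (d + 1)) :
    (contract (lin v) f).IsHomogeneous d := by
  rw [contract_lin]
  apply IsHomogeneous.sum
  intro i _
  rw [smul_eq_C_mul]
  exact IsHomogeneous.C_mul (pderiv_homog i hf) _

/-- Euler formula along dual bases, iterated. -/
theorem euler_iter {K : Type*} [CommRing K] {r : ℕ} {I : Type*} [Fintype I]
    (e x : I → Fin r → K)
    (hex : ∀ i, (X i : MvPolynomial (Fin r) K) = ∑ p, e p i • lin (x p)) (d : ℕ)
    (f : MvPolynomial (Fin r) K) (hf : f.IsHomogeneous d) :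
    (d.factorial : K) • f = ∑ P : Fin d → I,
      coeff 0 (contract (∏ m, lin (e (P m))) f) • ∏ m, lin (x (P m)) := by
  induction d generalizing f with
  | zero =>
    have h0 : f.totalDegree = 0 := by
      simpa using hf.totalDegree_le
    have := totalDegree_eq_zero_iff_eq_C.1 h0
    simp only [Nat.factorial_zero, Nat.cast_one, one_smul, Finset.univ_eq_empty, Finset.prod_empty]
    rw [← C_1, contract_C, one_smul, C_1, Fintype.sum_unique, smul_eq_C_mul, mul_one]
    exact this
  | succ d ih =>
    have hE : ((d + 1 : ℕ) : K) • f = ∑ p, lin (x p) * contract (lin (e p)) f := by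
      have := hf.sum_X_mul_pderiv
      rw [Nat.cast_smul_eq_nsmul, ← this]
      simp only [contract_lin, Finset.mul_sum]
      rw [Finset.sum_comm]
      refine Finset.sum_congr rfl fun i _ => ?_
      rw [hex i, Finset.sum_mul]
      refine Finset.sum_congr rfl fun p _ => ?_
      simp
    rw [Nat.factorial_succ, Nat.cast_mul, mul_comm, mul_smul, hE, Finset.smul_sum]
    rw [← (Fin.consEquiv (fun _ => I)).sum_comp, Fintype.sum_prod_type]
    refine Finset.sum_congr rfl fun p _ => ?_
    rw [← mul_smul_comm, ih _ (contract_lin_homog _ hf), Finset.mul_sum]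
    refine Finset.sum_congr rfl fun P _ => ?_
    simp only [Fin.consEquiv_apply, Fin.prod_univ_succ, Fin.cons_zero, Fin.cons_succ]
    rw [mul_comm (lin (e p)), contract_mul, mul_smul_comm]

end contractLemmas

section jordan

theorem exists_weights (K : Type*) [Field K] [CharZero K] :
    ∃ w : ℕ → ℕ → K, (∀ s i, s < i → w s i = 0) ∧
      ∀ s m, m ≤ s → ∑ i ∈ Finset.range (s + 1), w s i * (i : K) ^ m = if m = s then 1 else 0 := by
  classical
  refine ⟨fun s i => if i ≤ s then
    (∏ j ∈ (Finset.range (s + 1)).erase i, ((i : K) - (j : K)))⁻¹ else 0, ?_, ?_⟩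
  · intro s i h
    simp; omega
  · intro s m hm
    have hinj : Set.InjOn (fun i : ℕ => (i : K)) (Finset.range (s + 1)) :=
      fun a _ b _ h => Nat.cast_injective h
    have := Lagrange.coeff_eq_sum (s := Finset.range (s + 1)) hinj
      (P := (Polynomial.X : Polynomial K) ^ m) (by
        rw [Polynomial.degree_X_pow, Finset.card_range]; exact_mod_cast Nat.lt_succ_of_le hm)
    simp only [Polynomial.coeff_X_pow, Finset.card_range, Nat.add_sub_cancel] at this
    have hsw : (if m = s then (1 : K) else 0) = if s = m then 1 else 0 := by simp [eq_comm]
    rw [hsw, this]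
    refine Finset.sum_congr rfl fun i hi => ?_
    have hi2 : i ≤ s := by simpa [Nat.lt_succ_iff] using hi
    simp [hi2, div_eq_mul_inv, mul_comm]

theorem jordan_basis {K : Type*} [Field K] {V : Type*} [AddCommGroup V] [Module K V]
    [Module.Finite K V] (T : Module.End K V) (N : ℕ) (hT : T ^ N = 0) :
    ∃ (q : ℕ) (a : Fin q → ℕ) (e : Fin q → V)
      (b : Module.Basis (Σ j : Fin q, Fin (a j)) K V),
      (∀ p, b p = (T ^ (p.2 : ℕ)) (e p.1)) ∧ ∀ j, (T ^ (a j)) (e j) = 0 := by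
  classical
  have htors : Module.IsTorsion' (Module.AEval' T) (Submonoid.powers (Polynomial.X : Polynomial K)) := by
    rw [Submodule.isTorsion'_powers_iff]
    intro x
    refine ⟨N, ?_⟩
    obtain ⟨y, rfl⟩ := (Module.AEval'.of T).surjective x
    rw [Module.AEval'.X_pow_smul_of, hT]
    simp
  obtain ⟨q, a, ⟨φ⟩⟩ := Module.torsion_by_prime_power_decomposition
    (Polynomial.irreducible_X (R := K)) htors
  let E : Fin q → Module.AEval' T := fun j =>
    φ.symm (DirectSum.lof (Polynomial K) (Fin q) (fun i => Polynomial K ⧸ (Polynomial K ∙ (Polynomial.X : Polynomial K) ^ (a i))) j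
      (Submodule.Quotient.mk 1))
  let e : Fin q → V := fun j => (Module.AEval'.of T).symm (E j)
  have hE : ∀ j (p : Polynomial K), (Polynomial.aeval T p) (e j) =
      (Module.AEval'.of T).symm (φ.symm (DirectSum.lof (Polynomial K) (Fin q) (fun i => Polynomial K ⧸ (Polynomial K ∙ (Polynomial.X : Polynomial K) ^ (a i))) j
      (Submodule.Quotient.mk p))) := by
    intro j p
    have h1 : (Submodule.Quotient.mk p : Polynomial K ⧸ (Polynomial K ∙ (Polynomial.X : Polynomial K) ^ (a j))) = p • Submodule.Quotient.mk 1 := by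
      rw [← Submodule.Quotient.mk_smul]; simp
    rw [h1, map_smul, map_smul]
    rw [Module.AEval.of_symm_smul]
    rfl
  have hlin : LinearIndependent K (fun p : (Σ j : Fin q, Fin (a j)) => (T ^ (p.2 : ℕ)) (e p.1)) := by
    rw [Fintype.linearIndependent_iff]
    intro g hg
    let P : Fin q → Polynomial K := fun j => ∑ k : Fin (a j), Polynomial.C (g ⟨j, k⟩) * Polynomial.X ^ (k : ℕ)
    have h1 : ∑ j, (Polynomial.aeval T (P j)) (e j) = 0 := by
      rw [← hg, Fintype.sum_sigma]
      refine Finset.sum_congr rfl fun j _ => ?_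
      simp [P, LinearMap.sum_apply, Algebra.algebraMap_eq_smul_one]
    simp only [hE] at h1
    rw [← map_sum, ← map_sum, EmbeddingLike.map_eq_zero_iff, EmbeddingLike.map_eq_zero_iff] at h1
    have h2 : ∀ j, (Submodule.Quotient.mk (P j) : Polynomial K ⧸ (Polynomial K ∙ (Polynomial.X : Polynomial K) ^ (a j))) = 0 := by
      intro j
      have := congrArg (fun z => z j) h1
      simp only [DirectSum.sum_apply, DirectSum.lof_eq_of] at this
      rw [Finset.sum_eq_single j] at this
      · simpa using this
      · intro i _ hij
        exact DirectSum.of_eq_of_ne _ _ _ (by tauto)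
      · simp
    rintro ⟨j, k⟩
    have h3 := h2 j
    rw [Submodule.Quotient.mk_eq_zero, Submodule.mem_span_singleton] at h3
    obtain ⟨c, hc⟩ := h3
    have h4 : (Polynomial.X : Polynomial K) ^ (a j) ∣ P j := ⟨c, by rw [← hc]; simp [mul_comm]⟩
    rw [Polynomial.X_pow_dvd_iff] at h4
    have h5 := h4 k k.2
    simp only [P, Polynomial.finsetSum_coeff, Polynomial.coeff_C_mul, Polynomial.coeff_X_pow] at h5
    rw [Finset.sum_eq_single k] at h5
    · simpa using h5
    · intro i _ hik
      rw [if_neg (by intro h; exact hik (Fin.ext h.symm)), mul_zero]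
    · simp
  have hzero : ∀ j, (T ^ (a j)) (e j) = 0 := by
    intro j
    have := hE j (Polynomial.X ^ (a j))
    rw [(Submodule.Quotient.mk_eq_zero _).2 (Submodule.mem_span_singleton_self _)] at this
    simpa using this
  have hspan : ⊤ ≤ Submodule.span K (Set.range (fun p : (Σ j : Fin q, Fin (a j)) => (T ^ (p.2 : ℕ)) (e p.1))) := by
    intro v _
    have key : ∀ z : (DirectSum (Fin q) (fun i => Polynomial K ⧸ (Polynomial K ∙ (Polynomial.X : Polynomial K) ^ (a i)))),
        (Module.AEval'.of T).symm (φ.symm z) ∈ Submodule.span K (Set.range (fun p : (Σ j : Fin q, Fin (a j)) => (T ^ (p.2 : ℕ)) (e p.1))) := by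
      intro z
      induction z using DirectSum.induction_on with
      | zero => simp
      | add x y hx hy => rw [map_add, map_add]; exact Submodule.add_mem _ hx hy
      | of j x =>
        obtain ⟨p, rfl⟩ := Submodule.Quotient.mk_surjective _ x
        have := hE j p
        rw [DirectSum.lof_eq_of] at this
        rw [← this, Polynomial.aeval_eq_sum_range, LinearMap.sum_apply]
        refine Submodule.sum_mem _ fun k _ => ?_
        rw [LinearMap.smul_apply]
        refine Submodule.smul_mem _ _ ?_
        by_cases hk : k < a j
        · exact Submodule.subset_span ⟨⟨j, ⟨k, hk⟩⟩, rfl⟩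
        · obtain ⟨m, rfl⟩ := Nat.exists_eq_add_of_le (not_lt.1 hk)
          rw [add_comm, pow_add, Module.End.mul_apply, hzero]
          simp
    have := key (φ (Module.AEval'.of T v))
    simpa using this
  exact ⟨q, a, e, Module.Basis.mk hlin hspan, fun p => by simp, hzero⟩

theorem jordan_data {K : Type*} [Field K] {r n : ℕ} (B : Matrix (Fin r) (Fin r) K)
    (h1 : B ^ (n + 1) = 0) (h2 : B ^ n ≠ 0) :
    ∃ (q : ℕ) (a : Fin q → ℕ) (e : Fin q → Fin r → K) (x : Fin q → ℕ → Fin r → K),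
      (∀ j, a j ≤ n + 1) ∧ (∃ j0, a j0 = n + 1) ∧
      (∀ j k, a j ≤ k → (B ^ k).mulVec (e j) = 0) ∧ (∀ j k, a j ≤ k → x j k = 0) ∧
      (∀ v, v = ∑ j, ∑ k : Fin (n + 1), (x j k ⬝ᵥ v) • (B ^ (k : ℕ)).mulVec (e j)) ∧
      (∀ j k j' k', k < a j → k' < a j' →
        x j k ⬝ᵥ ((B ^ k').mulVec (e j')) = if j = j' ∧ k = k' then 1 else 0) := by
  classical
  have hpow : ∀ k v, ((Matrix.toLin' B) ^ k) v = (B ^ k).mulVec v := by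
    intro k v
    rw [← Matrix.toLin'_pow, Matrix.toLin'_apply]
  obtain ⟨q, a, e, b, hb, he⟩ := jordan_basis (Matrix.toLin' B) (n + 1) (by
    rw [← Matrix.toLin'_pow, h1, map_zero])
  simp only [hpow] at hb he
  have hz : ∀ j k, a j ≤ k → (B ^ k).mulVec (e j) = 0 := by
    intro j k hk
    obtain ⟨m, rfl⟩ := Nat.exists_eq_add_of_le hk
    rw [add_comm, pow_add, ← Matrix.mulVec_mulVec, he, Matrix.mulVec_zero]
  have ha : ∀ j, a j ≤ n + 1 := by
    intro j
    by_contra hlt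
    have := b.ne_zero ⟨j, ⟨n + 1, by omega⟩⟩
    rw [hb] at this
    simp [h1] at this
  let x : Fin q → ℕ → Fin r → K := fun j k => if h : k < a j then
    (fun i => b.coord ⟨j, ⟨k, h⟩⟩ (Pi.single i 1)) else 0
  have hx : ∀ j k (h : k < a j) v, x j k ⬝ᵥ v = b.coord ⟨j, ⟨k, h⟩⟩ v := by
    intro j k h v
    conv_rhs => rw [pi_eq_sum_univ' v]
    simp only [x, h, dite_true, dotProduct, map_sum, map_smul, smul_eq_mul]
    refine Finset.sum_congr rfl fun i _ => ?_
    rw [mul_comm]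
  have hexp : ∀ v, v = ∑ j, ∑ k : Fin (n + 1), (x j k ⬝ᵥ v) • (B ^ (k : ℕ)).mulVec (e j) := by
    intro v
    conv_lhs => rw [← b.sum_repr v, Fintype.sum_sigma]
    refine Finset.sum_congr rfl fun j _ => ?_
    rw [Fin.sum_univ_eq_sum_range (fun k => (x j k ⬝ᵥ v) • (B ^ (k : ℕ)).mulVec (e j))]
    rw [← Finset.sum_subset (Finset.range_mono (ha j))]
    · rw [← Fin.sum_univ_eq_sum_range (fun k => (x j k ⬝ᵥ v) • (B ^ (k : ℕ)).mulVec (e j))]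
      refine Finset.sum_congr rfl fun k _ => ?_
      rw [hx j k k.2, hb]
      rfl
    · intro k _ hk
      rw [hz j k (by simpa using hk), smul_zero]
  refine ⟨q, a, e, x, ha, ?_, hz, ?_, hexp, ?_⟩
  · by_contra hne
    push Not at hne
    apply h2
    have hzz : ∀ v, (B ^ n).mulVec v = 0 := by
      intro v
      rw [hexp v, Matrix.mulVec_sum]
      refine Finset.sum_eq_zero fun j _ => ?_
      rw [Matrix.mulVec_sum]
      refine Finset.sum_eq_zero fun k _ => ?_
      rw [Matrix.mulVec_smul, Matrix.mulVec_mulVec, ← pow_add, hz, smul_zero]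
      have := ha j
      have := hne j
      omega
    ext i j
    have := congrFun (hzz (Pi.single j 1)) i
    simpa using this
  · intro j k h
    simp [x, not_lt.2 h]
  · intro j k j' k' hk hk'
    have : (B ^ k').mulVec (e j') = b ⟨j', ⟨k', hk'⟩⟩ := (hb ⟨j', ⟨k', hk'⟩⟩).symm
    rw [hx j k hk, this, Module.Basis.coord_apply, Module.Basis.repr_self, Finsupp.single_apply]
    congr 1
    apply propext
    constructor
    · intro h
      cases h
      simp
    · rintro ⟨rfl, rfl⟩
      rfl

end jordan

section splitting

theorem shift_one {K Q : Type*} [CommRing K] [CommRing Q] {r : ℕ} (B : Matrix (Fin r) (Fin r) K)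
    (φ : (Fin r → K) → Q) (h : ∀ u v, φ (B.mulVec u) * φ v = φ u * φ (B.mulVec v))
    (c k : ℕ) (u v : Fin r → K) :
    φ ((B ^ c).mulVec u) * φ ((B ^ k).mulVec v) = φ ((B ^ (c + k)).mulVec u) * φ v := by
  induction k generalizing c with
  | zero => simp
  | succ k ih =>
    rw [pow_succ' B k, ← Matrix.mulVec_mulVec, ← h, Matrix.mulVec_mulVec, ← pow_succ', ih]
    congr 4
    omega

theorem shift_many {K Q : Type*} [CommRing K] [CommRing Q] {r : ℕ} (B : Matrix (Fin r) (Fin r) K)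
    (φ : (Fin r → K) → Q) (h : ∀ u v, φ (B.mulVec u) * φ v = φ u * φ (B.mulVec v))
    {ι : Type*} (S : Finset ι) (k : ι → ℕ) (v : ι → Fin r → K)
    (c : ℕ) (u : Fin r → K) :
    φ ((B ^ c).mulVec u) * ∏ m ∈ S, φ ((B ^ (k m)).mulVec (v m)) =
      φ ((B ^ (c + ∑ m ∈ S, k m)).mulVec u) * ∏ m ∈ S, φ (v m) := by
  classical
  induction S using Finset.induction_on generalizing c with
  | empty => simp
  | insert a s ha ih =>
    rw [Finset.prod_insert ha, Finset.prod_insert ha, Finset.sum_insert ha, ← mul_assoc,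
      shift_one B φ h, mul_right_comm, ih, add_assoc]
    ring

theorem lin_single {K : Type*} [CommSemiring K] {r : ℕ} (i : Fin r) :
    lin (Pi.single i (1 : K)) = X i := by
  classical
  rw [lin_apply]
  simp [Pi.single_apply, ite_smul]

theorem Mf_symm {K : Type*} [CommRing K] {r : ℕ} {f : MvPolynomial (Fin r) K}
    {A : Matrix (Fin r) (Fin r) K} (hA : A ∈ Mf f) (u v : Fin r → K) :
    Ideal.Quotient.mk (annIdeal f) (lin (A.transpose.mulVec u)) * Ideal.Quotient.mk (annIdeal f) (lin v) =
    Ideal.Quotient.mk (annIdeal f) (lin u) * Ideal.Quotient.mk (annIdeal f) (lin (A.transpose.mulVec v)) := by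
  have hB : ∀ u : Fin r → K, lin (A.transpose.mulVec u) = ∑ j, C (u j) * rowOp A j := by
    intro u
    simp only [lin_apply, rowOp, Matrix.mulVec, dotProduct, Finset.sum_smul, Finset.mul_sum,
      Matrix.transpose_apply]
    rw [Finset.sum_comm]
    refine Finset.sum_congr rfl fun j _ => Finset.sum_congr rfl fun k _ => ?_
    simp only [smul_eq_C_mul, C_mul]
    ring
  have hX : ∀ u : Fin r → K, lin u = ∑ j, C (u j) * X j := by
    intro u; simp [lin_apply, smul_eq_C_mul]
  have key : ∀ i j, Ideal.Quotient.mk (annIdeal f) (X i * rowOp A j) =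
      Ideal.Quotient.mk (annIdeal f) (X j * rowOp A i) := by
    intro i j
    rw [Ideal.Quotient.eq]
    exact hA i j
  rw [hB, hB, hX, hX, ← map_mul, ← map_mul, Finset.sum_mul_sum, Finset.sum_mul_sum, map_sum, map_sum]
  refine Finset.sum_congr rfl fun j _ => ?_
  rw [map_sum, map_sum]
  refine Finset.sum_congr rfl fun i _ => ?_
  have h1 : C (u j) * rowOp A j * (C (v i) * X i) = C (u j) * C (v i) * (X i * rowOp A j) := by ring
  have h2 : C (u j) * X j * (C (v i) * rowOp A i) = C (u j) * C (v i) * (X j * rowOp A i) := by ring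
  rw [h1, h2, map_mul, key, ← map_mul]

theorem expansion {K : Type*} [Field K] [CharZero K] {r d n : ℕ}
    (f : MvPolynomial (Fin r) K) (hf : f.IsHomogeneous (d + 1))
    (A : Matrix (Fin r) (Fin r) K) (hA : A ∈ Mf f)
    {q : ℕ} (a : Fin q → ℕ) (e : Fin q → Fin r → K) (x : Fin q → ℕ → Fin r → K)
    (hz : ∀ j k, a j ≤ k → (A.transpose ^ k).mulVec (e j) = 0)
    (hexp : ∀ v, v = ∑ j, ∑ k : Fin (n + 1), (x j k ⬝ᵥ v) • (A.transpose ^ (k : ℕ)).mulVec (e j)) :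
    ∃ cc : (Fin (d + 1) → Fin q) → ℕ → K,
      (∀ J s m, a (J m) ≤ s → cc J s = 0) ∧
      f = ∑ J : Fin (d + 1) → Fin q, ∑ k : Fin (d + 1) → Fin (n + 1),
        cc J (∑ m, (k m : ℕ)) • ∏ m, lin (x (J m) (k m)) := by
  classical
  set B := A.transpose with hBdef
  let c0 : (Fin (d + 1) → Fin q) → ℕ → K := fun J s =>
    coeff 0 (contract (lin ((B ^ s).mulVec (e (J 0))) *
      ∏ m ∈ Finset.univ.erase 0, lin (e (J m))) f)
  have factA : ∀ J (k : Fin (d + 1) → ℕ),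
      coeff 0 (contract (∏ m, lin ((B ^ (k m)).mulVec (e (J m)))) f) = c0 J (∑ m, k m) := by
    intro J k
    have : contract (∏ m, lin ((B ^ (k m)).mulVec (e (J m)))) f =
      contract (lin ((B ^ (∑ m, k m)).mulVec (e (J 0))) *
      ∏ m ∈ Finset.univ.erase 0, lin (e (J m))) f := by
      apply mk_eq_contract
      rw [← Finset.mul_prod_erase Finset.univ _ (Finset.mem_univ 0),
        ← Finset.add_sum_erase Finset.univ _ (Finset.mem_univ 0)]
      rw [map_mul, map_mul, map_prod, map_prod]
      exact shift_many B (fun v => Ideal.Quotient.mk (annIdeal f) (lin v)) (Mf_symm hA)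
        (Finset.univ.erase 0) k (fun m => e (J m)) (k 0) (e (J 0))
    rw [this]
  have factB : ∀ J s m, a (J m) ≤ s → c0 J s = 0 := by
    intro J s m h
    have h1 := factA J (Pi.single m s)
    rw [Finset.sum_pi_single' m s Finset.univ, if_pos (Finset.mem_univ _)] at h1
    rw [← h1, Finset.prod_eq_zero (Finset.mem_univ m), contract_zero_left, coeff_zero]
    rw [Pi.single_eq_same, hz _ _ h, map_zero]
  have hfac : ((d + 1).factorial : K) ≠ 0 := by exact_mod_cast (d + 1).factorial_ne_zero
  refine ⟨fun J s => ((d + 1).factorial : K)⁻¹ * c0 J s, ?_, ?_⟩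
  · intro J s m h
    simp [factB J s m h]
  · have hex : ∀ i, (X i : MvPolynomial (Fin r) K) =
        ∑ p : Fin q × Fin (n + 1), ((B ^ (p.2 : ℕ)).mulVec (e p.1)) i • lin (x p.1 p.2) := by
      intro i
      rw [← lin_single]
      simp only [← map_smul]
      rw [← map_sum]
      congr 1
      ext l
      have := congrFun (hexp (Pi.single l 1)) i
      rw [Fintype.sum_prod_type]
      simp only [Finset.sum_apply, Pi.smul_apply, smul_eq_mul, dotProduct_single_one] at this ⊢
      rw [Pi.single_comm, this]
      exact Finset.sum_congr rfl fun j _ => Finset.sum_congr rfl fun k _ => mul_comm _ _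
    have hE := euler_iter (fun p : Fin q × Fin (n + 1) => (B ^ (p.2 : ℕ)).mulVec (e p.1))
      (fun p => x p.1 p.2) hex (d + 1) f hf
    rw [← (Equiv.arrowProdEquivProdArrow (Fin (d + 1)) (fun _ => Fin q) (fun _ => Fin (n + 1))).symm.sum_comp, Fintype.sum_prod_type] at hE
    have hE2 := congrArg (fun z => ((d + 1).factorial : K)⁻¹ • z) hE
    simp only [smul_smul, inv_mul_cancel₀ hfac, one_smul, Finset.smul_sum] at hE2
    rw [hE2]
    refine Finset.sum_congr rfl fun J _ => Finset.sum_congr rfl fun k _ => ?_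
    simp only [Equiv.arrowProdEquivProdArrow, Equiv.coe_fn_symm_mk]
    rw [factA J (fun m => (k m : ℕ))]

theorem pderiv_pow_mem {F : Type*} [Field F] {r : ℕ} (M : Submodule F (MvPolynomial (Fin r) F))
    (hM : ∀ x ∈ M, x.IsHomogeneous 1) (i : Fin r) (k : ℕ) (x : MvPolynomial (Fin r) F)
    (hx : x ∈ M ^ k) : pderiv i x ∈ M ^ (k - 1) ∧ (k = 0 → pderiv i x = 0) := by
  induction hx using Submodule.pow_induction_on_left' with
  | algebraMap c =>
    have : pderiv i (algebraMap F (MvPolynomial (Fin r) F) c) = 0 := by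
      rw [algebraMap_eq, pderiv_C]
    rw [this]
    exact ⟨Submodule.zero_mem _, fun _ => rfl⟩
  | add x y k hx hy h1 h2 =>
    rw [map_add]
    exact ⟨Submodule.add_mem _ h1.1 h2.1, fun h => by rw [h1.2 h, h2.2 h, add_zero]⟩
  | mem_mul m hm k x hx ih =>
    refine ⟨?_, by simp⟩
    rw [Derivation.leibniz, Nat.succ_eq_add_one, Nat.add_sub_cancel]
    apply Submodule.add_mem
    · rcases Nat.eq_zero_or_pos k with h | h
      · rw [ih.2 h, smul_zero]; exact Submodule.zero_mem _
      · obtain ⟨k, rfl⟩ := Nat.exists_eq_add_of_lt h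
        have := ih.1
        simp only [zero_add, Nat.add_sub_cancel] at this ⊢
        rw [pow_succ']
        exact Submodule.mul_mem_mul hm this
    · have h0 := pderiv_homog (d := 0) i (hM m hm)
      have h1 := totalDegree_eq_zero_iff_eq_C.1 (by simpa using h0.totalDegree_le)
      rw [h1, smul_eq_mul, mul_comm, ← smul_eq_C_mul]
      exact Submodule.smul_mem _ _ hx

theorem derivMulti_pow_mem {F : Type*} [Field F] {r : ℕ} (M : Submodule F (MvPolynomial (Fin r) F))
    (hM : ∀ x ∈ M, x.IsHomogeneous 1) (n k : ℕ) (β : Fin r →₀ ℕ) (hβ : β.degree = n)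
    (x : MvPolynomial (Fin r) F)
    (hx : x ∈ M ^ (k + n)) : derivMulti β x ∈ M ^ k := by
  induction n generalizing β k with
  | zero =>
    rw [Finsupp.degree_eq_zero_iff] at hβ
    subst hβ
    rw [derivMulti_zero]; exact hx
  | succ n ih =>
    have hne : β ≠ 0 := by
      rintro rfl
      simp at hβ
    obtain ⟨i, hi⟩ := Finsupp.ne_iff.1 hne
    have hle : Finsupp.single i 1 ≤ β := by
      simp at hi ⊢; omega
    obtain ⟨γ, rfl⟩ := exists_add_of_le hle
    rw [derivMulti_single_add]
    have hγ : γ.degree = n := by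
      rw [map_add, Finsupp.degree_single] at hβ
      omega
    have := ih (k + 1) γ hγ (by convert hx using 2; omega)
    exact (pderiv_pow_mem M hM i (k + 1) _ this).1

theorem partials_le {F : Type*} [Field F] {r : ℕ} (M : Submodule F (MvPolynomial (Fin r) F))
    (hM : ∀ x ∈ M, x.IsHomogeneous 1) (d : ℕ) (x : MvPolynomial (Fin r) F)
    (hx : x ∈ M ^ (d + 1)) : partials d x ≤ M := by
  unfold partials
  rw [Submodule.span_le]
  rintro p ⟨D, hD, rfl⟩
  unfold contract
  refine Submodule.sum_mem _ fun β hβ => Submodule.smul_mem _ _ ?_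
  have hdeg : β.degree = d := by
    have := hD (mem_support_iff.1 hβ)
    rwa [Finsupp.degree_eq_weight_one]
  have := derivMulti_pow_mem M hM d 1 β hdeg x (by rwa [add_comm])
  rwa [pow_one] at this

theorem pow_homog {F : Type*} [Field F] {r : ℕ} (M : Submodule F (MvPolynomial (Fin r) F))
    (hM : ∀ x ∈ M, x.IsHomogeneous 1) (d : ℕ) (x : MvPolynomial (Fin r) F)
    (hx : x ∈ M ^ d) : x.IsHomogeneous d := by
  induction hx using Submodule.pow_induction_on_left' with
  | algebraMap c => exact isHomogeneous_C _ _
  | add x y k hx hy h1 h2 => exact h1.add h2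
  | mem_mul m hm k x hx ih => rw [Nat.succ_eq_add_one, add_comm]; exact (hM m hm).mul ih

theorem eq_zero_of_partials {F : Type*} [Field F] [CharZero F] {r d : ℕ}
    (g : MvPolynomial (Fin r) F) (hg : g.IsHomogeneous (d + 1)) (h : partials d g ≤ ⊥) : g = 0 := by
  classical
  have hex : ∀ i, (X i : MvPolynomial (Fin r) F) = ∑ p : Fin r, (Pi.single p (1 : F) : Fin r → F) i • lin (Pi.single p (1 : F)) := by
    intro i
    simp [lin_single, Pi.single_apply, ite_smul]
  have hE := euler_iter (fun p : Fin r => (Pi.single p (1 : F) : Fin r → F)) (fun p => Pi.single p 1) hex (d + 1) g hg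
  have hz : ∀ P : Fin (d + 1) → Fin r, contract (∏ m, lin (Pi.single (P m) (1 : F))) g = 0 := by
    intro P
    rw [Fin.prod_univ_succ, contract_mul]
    have : contract (∏ m : Fin d, lin (Pi.single (P m.succ) (1 : F))) g ∈ partials d g := by
      apply Submodule.subset_span
      refine ⟨_, ?_, rfl⟩
      have := IsHomogeneous.prod Finset.univ (fun m : Fin d => lin (Pi.single (P m.succ) (1 : F))) (fun _ => 1)
        (fun m _ => lin_homog _)
      simpa using this
    have := h this
    rw [Submodule.mem_bot] at this
    rw [this, contract_zero_right]
  simp only [hz, coeff_zero, zero_smul, Finset.sum_const_zero] at hE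
  have hfac : ((d + 1).factorial : F) ≠ 0 := by exact_mod_cast (d + 1).factorial_ne_zero
  exact (smul_eq_zero.1 hE).resolve_left hfac

theorem regSplit_of {F : Type*} [Field F] [CharZero F] {r d N : ℕ}
    (M : Fin (N + 1) → Submodule F (MvPolynomial (Fin r) F))
    (hM : ∀ i, ∀ x ∈ M i, x.IsHomogeneous 1)
    (hind : iSupIndep M) (g : Fin (N + 1) → MvPolynomial (Fin r) F)
    (hg : ∀ i, g i ∈ M i ^ (d + 1)) (hg0 : ∀ i, g i ≠ 0) :
    IsRegSplit (d + 1) (∑ i, g i) (Set.range g) ∧ (Set.range g).ncard = N + 1 := by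
  have hhom : ∀ i, (g i).IsHomogeneous (d + 1) := fun i => pow_homog _ (hM i) _ _ (hg i)
  have hpart : ∀ i, partials d (g i) ≤ M i := fun i => partials_le _ (hM i) _ _ (hg i)
  have hinj : Function.Injective g := by
    intro i j hij
    by_contra hne
    apply hg0 i
    apply eq_zero_of_partials _ (hhom i)
    exact (hind.pairwiseDisjoint hne) (hpart i) (by rw [hij]; exact hpart j)
  refine ⟨⟨Set.finite_range g, Set.range_nonempty g, ?_, ?_, ?_⟩, ?_⟩
  · rintro _ ⟨i, rfl⟩
    exact ⟨hg0 i, hhom i⟩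
  · rw [finsum_mem_range hinj, finsum_eq_sum_of_fintype]
  · rintro _ ⟨i, rfl⟩
    refine (hind i).mono (hpart i) ?_
    refine iSup₂_le ?_
    rintro _ ⟨⟨j, rfl⟩, hj⟩
    have hne : j ≠ i := by
      rintro rfl
      exact hj rfl
    exact (hpart j).trans (le_iSup₂_of_le j hne le_rfl)
  · rw [← Set.image_univ, Set.ncard_image_of_injective _ hinj, Set.ncard_univ]
    simp

theorem prod_mem_pow {F R ι : Type*} [CommSemiring F] [CommSemiring R] [Algebra F R]
    (M : Submodule F R) (S : Finset ι) (g : ι → R) (h : ∀ m ∈ S, g m ∈ M) :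
    ∏ m ∈ S, g m ∈ M ^ S.card := by
  classical
  induction S using Finset.induction_on with
  | empty => simpa using ⟨1, map_one _⟩
  | insert a s ha ih =>
    rw [Finset.prod_insert ha, Finset.card_insert_of_notMem ha, pow_succ']
    exact Submodule.mul_mem_mul (h a (by simp)) (ih fun m hm => h m (by simp [hm]))

end splitting

section deformation

/-- The deformed linear form `∑ₖ (i τ)^k x_{j,k}` over the `K`-algebra `S`. -/
noncomputable def ell {K S : Type*} [Field K] [CommRing S] [Algebra K S] {r q : ℕ} (n : ℕ)
    (x : Fin q → ℕ → Fin r → K) (τ : S) (j : Fin q) (i : ℕ) : MvPolynomial (Fin r) S :=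
  ∑ k : Fin (n + 1), C (((i : S) * τ) ^ (k : ℕ)) * map (algebraMap K S) (lin (x j k))

theorem map_lin {K S : Type*} [CommRing K] [CommRing S] (ψ : K →+* S) {r : ℕ} (v : Fin r → K) :
    map ψ (lin v) = lin (ψ ∘ v) := by
  simp [lin_apply, smul_eq_C_mul]

theorem ell_homog {K S : Type*} [Field K] [CommRing S] [Algebra K S] {r q : ℕ} (n : ℕ)
    (x : Fin q → ℕ → Fin r → K) (τ : S) (j : Fin q) (i : ℕ) :
    (ell n x τ j i).IsHomogeneous 1 := by
  unfold ell
  apply IsHomogeneous.sum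
  intro k _
  apply IsHomogeneous.C_mul
  rw [map_lin]
  exact lin_homog _

theorem ell_prod {K S : Type*} [Field K] [CommRing S] [Algebra K S] {r q d : ℕ} (n : ℕ)
    (x : Fin q → ℕ → Fin r → K) (τ : S) (J : Fin d → Fin q) (i : ℕ) :
    ∏ m, ell n x τ (J m) i = ∑ k : Fin d → Fin (n + 1),
      C (((i : S) * τ) ^ (∑ m, (k m : ℕ))) *
        ∏ m, map (algebraMap K S) (lin (x (J m) (k m))) := by
  classical
  unfold ell
  rw [Finset.prod_univ_sum, Fintype.piFinset_univ]
  refine Finset.sum_congr rfl fun k _ => ?_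
  rw [Finset.prod_mul_distrib, ← map_prod, Finset.prod_pow_eq_pow_sum]

theorem ell_linInd {K F : Type*} [Field K] [Field F] [CharZero F] [Algebra K F] {r q n : ℕ}
    (a : Fin q → ℕ) (x : Fin q → ℕ → Fin r → K) (b : Fin q → ℕ → Fin r → K)
    (ha : ∀ j, a j ≤ n + 1) (hx0 : ∀ j k, a j ≤ k → x j k = 0)
    (hdual : ∀ j k j' k', k < a j → k' < a j' →
        x j k ⬝ᵥ (b j' k') = if j = j' ∧ k = k' then 1 else 0)
    (τ : F) (hτ : τ ≠ 0) :
    LinearIndependent F (fun p : (Σ j : Fin q, Fin (a j)) => ell n x τ p.1 p.2) := by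
  classical
  rw [Fintype.linearIndependent_iff]
  intro c hc
  have hD : ∀ j' k' , k' < a j' → ∀ j (i : ℕ),
      contract (lin (algebraMap K F ∘ b j' k')) (ell n x τ j i) =
        C (if j = j' then ((i : F) * τ) ^ k' else 0) := by
    intro j' k' hk' j i
    have h1 : ∀ k : ℕ, contract (lin (algebraMap K F ∘ b j' k'))
        (map (algebraMap K F) (lin (x j k))) = C (if j = j' ∧ k = k' then 1 else 0) := by
      intro k
      rw [map_lin, contract_lin_lin, dotProduct_comm, ← RingHom.map_dotProduct]
      by_cases hk : k < a j
      · rw [hdual j k j' k' hk hk']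
        split_ifs <;> simp
      · rw [hx0 j k (not_lt.1 hk), if_neg]
        · simp
        · rintro ⟨rfl, rfl⟩
          exact hk hk'
    unfold ell
    have h2 : ∀ (s : Finset (Fin (n + 1))) (D : MvPolynomial (Fin r) F) (h : Fin (n + 1) → MvPolynomial (Fin r) F),
        contract D (∑ k ∈ s, h k) = ∑ k ∈ s, contract D (h k) := by
      intro s D h
      induction s using Finset.induction_on with
      | empty => simp [contract_zero_right]
      | insert a s ha ih => rw [Finset.sum_insert ha, Finset.sum_insert ha, contract_add_right, ih]
    rw [h2]
    have h3 : ∀ (y : F) (D p : MvPolynomial (Fin r) F), contract D (C y * p) = C y * contract D p := by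
      intro y D p
      rw [← smul_eq_C_mul, ← contract_C, ← contract_mul, mul_comm, contract_mul, contract_C,
        smul_eq_C_mul]
    simp only [h3, h1]
    by_cases hj : j = j'
    · subst hj
      have hk2 : k' < n + 1 := lt_of_lt_of_le hk' (ha j)
      rw [Finset.sum_eq_single (⟨k', hk2⟩ : Fin (n + 1))]
      · simp
      · intro k _ hk
        rw [if_neg]
        · simp
        · rintro ⟨_, rfl⟩
          exact hk rfl
      · simp
    · simp [hj]
  have h4 : ∀ j' k', k' < a j' → ∑ i : Fin (a j'), c ⟨j', i⟩ * ((i : F) * τ) ^ k' = 0 := by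
    intro j' k' hk'
    have h5 : contract (lin (algebraMap K F ∘ b j' k')) (∑ p : (Σ j : Fin q, Fin (a j)), c p • ell n x τ p.1 p.2) = 0 := by
      rw [hc, contract_zero_right]
    have h2 : ∀ (s : Finset (Σ j : Fin q, Fin (a j))) (D : MvPolynomial (Fin r) F) (h : (Σ j : Fin q, Fin (a j)) → MvPolynomial (Fin r) F),
        contract D (∑ k ∈ s, h k) = ∑ k ∈ s, contract D (h k) := by
      intro s D h
      induction s using Finset.induction_on with
      | empty => simp [contract_zero_right]
      | insert a s ha ih => rw [Finset.sum_insert ha, Finset.sum_insert ha, contract_add_right, ih]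
    have h3 : ∀ (y : F) (D p : MvPolynomial (Fin r) F), contract D (y • p) = y • contract D p := by
      intro y D p
      rw [← contract_C, ← contract_mul, mul_comm, contract_mul, contract_C]
    rw [h2] at h5
    simp only [h3, hD j' k' hk'] at h5
    rw [Fintype.sum_sigma, Finset.sum_eq_single j'] at h5
    · simp only [if_true, smul_eq_C_mul, ← C_mul, ← map_sum] at h5
      exact C_eq_zero.1 h5
    · intro j _ hj
      simp [hj]
    · simp
  rintro ⟨j, i⟩
  have hinj : Function.Injective (fun i : Fin (a j) => ((i : ℕ) : F) * τ) := by
    intro i i' h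
    have := mul_right_cancel₀ hτ h
    exact Fin.ext (Nat.cast_injective this)
  have h6 := Matrix.eq_zero_of_forall_pow_sum_mul_pow_eq_zero (v := fun i => c ⟨j, i⟩) hinj
    (fun k => h4 j k k.2)
  exact congrFun h6 i

/-- The span of the deformed linear forms with eigenvalue index `i`. -/
noncomputable def Msp {K F : Type*} [Field K] [Field F] [Algebra K F] {r q : ℕ} (n : ℕ)
    (a : Fin q → ℕ) (x : Fin q → ℕ → Fin r → K) (τ : F) (i : Fin (n + 1)) :
    Submodule F (MvPolynomial (Fin r) F) :=
  Submodule.span F ((fun p : (Σ j : Fin q, Fin (a j)) => ell n x τ p.1 p.2) ''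
    {p | (p.2 : ℕ) = i})

theorem ell_mem_Msp {K F : Type*} [Field K] [Field F] [Algebra K F] {r q : ℕ} (n : ℕ)
    (a : Fin q → ℕ) (x : Fin q → ℕ → Fin r → K) (τ : F) (i : Fin (n + 1)) (j : Fin q)
    (h : (i : ℕ) < a j) : ell n x τ j i ∈ Msp n a x τ i :=
  Submodule.subset_span ⟨⟨j, ⟨i, h⟩⟩, rfl, rfl⟩

theorem Msp_homog {K F : Type*} [Field K] [Field F] [Algebra K F] {r q : ℕ} (n : ℕ)
    (a : Fin q → ℕ) (x : Fin q → ℕ → Fin r → K) (τ : F) (i : Fin (n + 1)) :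
    ∀ y ∈ Msp n a x τ i, y.IsHomogeneous 1 := by
  have : Msp n a x τ i ≤ homogeneousSubmodule (Fin r) F 1 := by
    unfold Msp
    rw [Submodule.span_le]
    rintro _ ⟨p, _, rfl⟩
    exact ell_homog _ _ _ _ _
  exact this

theorem Msp_indep {K F : Type*} [Field K] [Field F] [Algebra K F] {r q : ℕ} (n : ℕ)
    (a : Fin q → ℕ) (x : Fin q → ℕ → Fin r → K) (τ : F)
    (h : LinearIndependent F (fun p : (Σ j : Fin q, Fin (a j)) => ell n x τ p.1 p.2)) :
    iSupIndep (Msp n a x τ) := by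
  intro i
  have hd : Disjoint {p : (Σ j : Fin q, Fin (a j)) | (p.2 : ℕ) = i} {p | (p.2 : ℕ) ≠ i} := by
    rw [Set.disjoint_left]
    intro p hp hp2
    exact hp2 hp
  refine (h.disjoint_span_image hd).mono le_rfl ?_
  refine iSup₂_le fun j hj => ?_
  refine Submodule.span_mono (Set.image_mono ?_)
  intro p hp hpi
  exact hj (Fin.ext (hp.symm.trans hpi))

/-- The complete-homogeneous-type coefficient. -/
noncomputable def hco {K S : Type*} [Field K] [CommRing S] [Algebra K S] (w : ℕ → ℕ → K) (τ : S)
    (m s : ℕ) : S :=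
  if m < s then 0 else
    algebraMap K S (∑ i ∈ Finset.range (s + 1), w s i * (i : K) ^ m) * τ ^ (m - s)

theorem hco_mul {K S : Type*} [Field K] [CommRing S] [Algebra K S] (w : ℕ → ℕ → K)
    (hw0 : ∀ s i, s < i → w s i = 0)
    (hw : ∀ s m, m ≤ s → ∑ i ∈ Finset.range (s + 1), w s i * (i : K) ^ m = if m = s then 1 else 0)
    (τ : S) (n m s : ℕ) (hs : s ≤ n) :
    hco w τ m s * τ ^ s = ∑ i : Fin (n + 1), algebraMap K S (w s i) * ((i : S) * τ) ^ m := by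
  have h1 : ∑ i : Fin (n + 1), algebraMap K S (w s i) * ((i : S) * τ) ^ m =
      algebraMap K S (∑ i ∈ Finset.range (s + 1), w s i * (i : K) ^ m) * τ ^ m := by
    rw [Fin.sum_univ_eq_sum_range (fun i => algebraMap K S (w s i) * ((i : S) * τ) ^ m),
      ← Finset.sum_subset (Finset.range_mono (Nat.succ_le_succ hs)), map_sum, Finset.sum_mul]
    · refine Finset.sum_congr rfl fun i _ => ?_
      simp [mul_pow, mul_assoc]
    · intro i _ hi
      rw [hw0 s i (by simpa using hi)]
      simp
  rw [h1]
  unfold hco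
  split_ifs with h
  · rw [hw s m h.le, if_neg h.ne]
    simp
  · rw [mul_assoc, ← pow_add, Nat.sub_add_cancel (not_lt.1 h)]

theorem hco_zero {K S : Type*} [Field K] [CommRing S] [Algebra K S] (w : ℕ → ℕ → K)
    (hw : ∀ s m, m ≤ s → ∑ i ∈ Finset.range (s + 1), w s i * (i : K) ^ m = if m = s then 1 else 0)
    (m s : ℕ) :
    hco w (0 : S) m s = if m = s then 1 else 0 := by
  unfold hco
  rcases lt_trichotomy m s with h | h | h
  · rw [if_pos h, if_neg h.ne]
  · subst h
    simp [hw m m le_rfl]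
  · rw [if_neg h.not_gt, if_neg h.ne', zero_pow (by omega), mul_zero]

theorem map_hco {K S S' : Type*} [Field K] [CommRing S] [Algebra K S] [CommRing S'] [Algebra K S']
    (ψ : S →+* S') (hψ : ψ.comp (algebraMap K S) = algebraMap K S') (w : ℕ → ℕ → K) (τ : S)
    (m s : ℕ) : ψ (hco w τ m s) = hco w (ψ τ) m s := by
  unfold hco
  split_ifs
  · simp
  · rw [map_mul, map_pow, ← hψ]
    rfl

/-- The deformed polynomial. -/
noncomputable def defo {K S : Type*} [Field K] [CommRing S] [Algebra K S] {r q : ℕ} (n d : ℕ)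
    (x : Fin q → ℕ → Fin r → K) (cc : (Fin (d + 1) → Fin q) → ℕ → K) (w : ℕ → ℕ → K) (τ : S) :
    MvPolynomial (Fin r) S :=
  ∑ J : Fin (d + 1) → Fin q, ∑ k : Fin (d + 1) → Fin (n + 1),
    C (∑ s ∈ Finset.range (n + 1), algebraMap K S (cc J s) * hco w τ (∑ m, (k m : ℕ)) s) *
      ∏ m, map (algebraMap K S) (lin (x (J m) (k m)))

theorem defo_homog {K S : Type*} [Field K] [CommRing S] [Algebra K S] {r q : ℕ} (n d : ℕ)
    (x : Fin q → ℕ → Fin r → K) (cc : (Fin (d + 1) → Fin q) → ℕ → K) (w : ℕ → ℕ → K) (τ : S) :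
    (defo n d x cc w τ).IsHomogeneous (d + 1) := by
  unfold defo
  refine IsHomogeneous.sum _ _ _ fun J _ => IsHomogeneous.sum _ _ _ fun k _ => ?_
  apply IsHomogeneous.C_mul
  have := IsHomogeneous.prod Finset.univ
    (fun m : Fin (d + 1) => map (algebraMap K S) (lin (x (J m) (k m)))) (fun _ => 1)
    (fun m _ => by rw [map_lin]; exact lin_homog _)
  simpa using this

theorem map_defo {K S S' : Type*} [Field K] [CommRing S] [Algebra K S] [CommRing S'] [Algebra K S']
    (ψ : S →+* S') (hψ : ψ.comp (algebraMap K S) = algebraMap K S') {r q : ℕ} (n d : ℕ)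
    (x : Fin q → ℕ → Fin r → K) (cc : (Fin (d + 1) → Fin q) → ℕ → K) (w : ℕ → ℕ → K) (τ : S) :
    map ψ (defo n d x cc w τ) = defo n d x cc w (ψ τ) := by
  have h1 : ∀ y, ψ (algebraMap K S y) = algebraMap K S' y := fun y => by rw [← hψ]; rfl
  simp only [defo, map_sum, map_mul, map_C, map_prod, map_map, hψ, h1, map_hco ψ hψ]

theorem map_ell {K S S' : Type*} [Field K] [CommRing S] [Algebra K S] [CommRing S'] [Algebra K S']
    (ψ : S →+* S') (hψ : ψ.comp (algebraMap K S) = algebraMap K S') {r q : ℕ} (n : ℕ)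
    (x : Fin q → ℕ → Fin r → K) (τ : S) (j : Fin q) (i : ℕ) :
    map ψ (ell n x τ j i) = ell n x (ψ τ) j i := by
  simp [ell, map_map, hψ]

theorem defo_zero {K : Type*} [Field K] {r q : ℕ} (n d : ℕ)
    (a : Fin q → ℕ) (ha : ∀ j, a j ≤ n + 1)
    (x : Fin q → ℕ → Fin r → K) (cc : (Fin (d + 1) → Fin q) → ℕ → K)
    (hcc : ∀ J s m, a (J m) ≤ s → cc J s = 0) (w : ℕ → ℕ → K)
    (hw : ∀ s m, m ≤ s → ∑ i ∈ Finset.range (s + 1), w s i * (i : K) ^ m = if m = s then 1 else 0) :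
    defo n d x cc w (0 : K) = ∑ J : Fin (d + 1) → Fin q, ∑ k : Fin (d + 1) → Fin (n + 1),
        cc J (∑ m, (k m : ℕ)) • ∏ m, lin (x (J m) (k m)) := by
  unfold defo
  refine Finset.sum_congr rfl fun J _ => Finset.sum_congr rfl fun k _ => ?_
  rw [smul_eq_C_mul]
  congr 1
  · congr 1
    simp only [hco_zero w hw, Algebra.algebraMap_self, RingHom.id_apply, mul_ite, mul_one, mul_zero]
    rw [Finset.sum_ite_eq]
    split_ifs with h
    · rfl
    · rw [hcc J _ 0]
      have := ha (J 0)
      simp at h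
      omega
  · refine Finset.prod_congr rfl fun m _ => ?_
    rw [Algebra.algebraMap_self, map_id]

/-- The pieces of the deformation. -/
noncomputable def piece {K F : Type*} [Field K] [Field F] [Algebra K F] {r q : ℕ} (n d : ℕ)
    (x : Fin q → ℕ → Fin r → K) (cc : (Fin (d + 1) → Fin q) → ℕ → K) (w : ℕ → ℕ → K) (τ : F)
    (i : Fin (n + 1)) : MvPolynomial (Fin r) F :=
  ∑ J : Fin (d + 1) → Fin q, ∑ s ∈ Finset.range (n + 1),
    (algebraMap K F (cc J s) * (τ ^ s)⁻¹ * algebraMap K F (w s i)) • ∏ m, ell n x τ (J m) i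

theorem sum_piece {K F : Type*} [Field K] [Field F] [Algebra K F] {r q : ℕ} (n d : ℕ)
    (x : Fin q → ℕ → Fin r → K) (cc : (Fin (d + 1) → Fin q) → ℕ → K) (w : ℕ → ℕ → K)
    (hw0 : ∀ s i, s < i → w s i = 0)
    (hw : ∀ s m, m ≤ s → ∑ i ∈ Finset.range (s + 1), w s i * (i : K) ^ m = if m = s then 1 else 0)
    (τ : F) (hτ : τ ≠ 0) :
    defo n d x cc w τ = ∑ i, piece n d x cc w τ i := by
  have hh : ∀ m s, s ∈ Finset.range (n + 1) → hco w τ m s =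
      ∑ i : Fin (n + 1), (τ ^ s)⁻¹ * algebraMap K F (w s i) * ((i : F) * τ) ^ m := by
    intro m s hs
    have h1 := hco_mul w hw0 hw τ n m s (by simpa [Nat.lt_succ_iff] using hs)
    have h2 : hco w τ m s = (τ ^ s)⁻¹ * (hco w τ m s * τ ^ s) := by
      have := pow_ne_zero s hτ
      field_simp
    rw [h2, h1, Finset.mul_sum]
    refine Finset.sum_congr rfl fun i _ => ?_
    rw [mul_assoc]
  unfold defo piece
  conv_rhs => rw [Finset.sum_comm]
  refine Finset.sum_congr rfl fun J _ => ?_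
  simp only [ell_prod, Finset.smul_sum]
  have h3 : ∀ k : Fin (d + 1) → Fin (n + 1),
      C (∑ s ∈ Finset.range (n + 1), algebraMap K F (cc J s) * hco w τ (∑ m, (k m : ℕ)) s) *
        ∏ m, map (algebraMap K F) (lin (x (J m) (k m))) =
      ∑ i : Fin (n + 1), ∑ s ∈ Finset.range (n + 1),
        (algebraMap K F (cc J s) * (τ ^ s)⁻¹ * algebraMap K F (w s i)) •
          (C (((i : F) * τ) ^ (∑ m, (k m : ℕ))) *
            ∏ m, map (algebraMap K F) (lin (x (J m) (k m)))) := by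
    intro k
    rw [Finset.sum_comm, map_sum, Finset.sum_mul]
    refine Finset.sum_congr rfl fun s hs => ?_
    rw [hh _ s hs, Finset.mul_sum, map_sum, Finset.sum_mul]
    refine Finset.sum_congr rfl fun i _ => ?_
    simp only [smul_eq_C_mul, C_mul]
    ring
  rw [Finset.sum_congr rfl fun k _ => h3 k, Finset.sum_comm]
  refine Finset.sum_congr rfl fun i _ => ?_
  rw [Finset.sum_comm]

theorem piece_mem {K F : Type*} [Field K] [Field F] [Algebra K F] {r q : ℕ} (n d : ℕ)
    (a : Fin q → ℕ)
    (x : Fin q → ℕ → Fin r → K) (cc : (Fin (d + 1) → Fin q) → ℕ → K)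
    (hcc : ∀ J s m, a (J m) ≤ s → cc J s = 0) (w : ℕ → ℕ → K)
    (hw0 : ∀ s i, s < i → w s i = 0) (τ : F) (i : Fin (n + 1)) :
    piece n d x cc w τ i ∈ Msp n a x τ i ^ (d + 1) := by
  unfold piece
  refine Submodule.sum_mem _ fun J _ => Submodule.sum_mem _ fun s _ => ?_
  by_cases h1 : ∃ m, a (J m) ≤ s
  · obtain ⟨m, hm⟩ := h1
    rw [hcc J s m hm]
    simp
  by_cases h2 : s < i
  · rw [hw0 s i h2]
    simp
  push Not at h1 h2
  refine Submodule.smul_mem _ _ ?_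
  have := prod_mem_pow (Msp n a x τ i) Finset.univ (fun m => ell n x τ (J m) i)
    (fun m _ => ell_mem_Msp n a x τ i (J m) (lt_of_le_of_lt h2 (h1 m)))
  simpa using this

end deformation

theorem core {K S F : Type*} [Field K] [CharZero K] [CommRing S] [Algebra K S] [Field F]
    [CharZero F] [Algebra K F] {r d : ℕ}
    (f : MvPolynomial (Fin r) K) (hf : f.IsHomogeneous (d + 1))
    (A : Matrix (Fin r) (Fin r) K) (hA : A ∈ Mf f) {n : ℕ}
    (hA1 : A ^ (n + 1) = 0) (hA2 : A ^ n ≠ 0)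
    (φ : S →+* F) (hφi : Function.Injective φ)
    (hφK : φ.comp (algebraMap K S) = algebraMap K F) (ε : S →+* K)
    (he : ε.comp (algebraMap K S) = algebraMap K K) (t : S) (htne : t ≠ 0) (ht0 : ε t = 0) :
    ∃ ft : MvPolynomial (Fin r) S,
      ft.IsHomogeneous (d + 1) ∧
      MvPolynomial.map ε ft = f ∧
      ∃ G : Set (MvPolynomial (Fin r) F),
        IsRegSplit (d + 1) (MvPolynomial.map φ ft) G ∧ G.ncard = n + 1 := by
  classical
  have hB1 : A.transpose ^ (n + 1) = 0 := by
    rw [← Matrix.transpose_pow, hA1, Matrix.transpose_zero]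
  have hB2 : A.transpose ^ n ≠ 0 := by
    rw [← Matrix.transpose_pow]
    intro h
    exact hA2 (Matrix.transpose_eq_zero.1 h)
  obtain ⟨q, a, e, x, ha, ⟨j0, hj0⟩, hz, hx0, hexp, hdual⟩ := jordan_data A.transpose hB1 hB2
  obtain ⟨cc, hcc, hfe⟩ := expansion f hf A hA a e x hz hexp
  obtain ⟨w, hw0, hw⟩ := exists_weights K
  obtain ⟨τ, hτd⟩ : ∃ τ : F, τ = φ t := ⟨_, rfl⟩
  have hτ : τ ≠ 0 := by
    rw [hτd, Ne, map_eq_zero_iff φ hφi]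
    exact htne
  have hli := ell_linInd a x (fun j k => (A.transpose ^ k).mulVec (e j)) ha hx0 hdual τ hτ
  have hi0 : ∀ i : Fin (n + 1), (i : ℕ) < a j0 := fun i => by rw [hj0]; exact i.2
  have hne : ∀ i : Fin (n + 1), ell n x τ j0 i ≠ 0 := by
    intro i
    have h := hli.ne_zero (⟨j0, ⟨(i : ℕ), hi0 i⟩⟩ : (Σ j : Fin q, Fin (a j)))
    exact h
  obtain ⟨P, hP⟩ : ∃ P : Fin (n + 1) → MvPolynomial (Fin r) F, ∀ i, P i = piece n d x cc w τ i :=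
    ⟨fun i => piece n d x cc w τ i, fun _ => rfl⟩
  have hP0 : ∑ i, P i = defo n d x cc w τ := by
    simp only [hP]
    exact (sum_piece n d x cc w hw0 hw τ hτ).symm
  obtain ⟨g, hg⟩ : ∃ g : Fin (n + 1) → MvPolynomial (Fin r) F, ∀ i,
      g i = P i + if P i = 0 then C τ * ell n x τ j0 i ^ (d + 1) else 0 :=
    ⟨fun i => P i + if P i = 0 then C τ * ell n x τ j0 i ^ (d + 1) else 0, fun _ => rfl⟩
  have hgne : ∀ i, g i ≠ 0 := by
    intro i
    rw [hg]
    split_ifs with h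
    · rw [h, zero_add]
      exact mul_ne_zero (by simpa using hτ) (pow_ne_zero _ (hne i))
    · rwa [add_zero]
  have hgm : ∀ i, g i ∈ Msp n a x τ i ^ (d + 1) := by
    intro i
    rw [hg]
    refine Submodule.add_mem _ (by rw [hP]; exact piece_mem n d a x cc hcc w hw0 τ i) ?_
    split_ifs
    · rw [← smul_eq_C_mul]
      exact Submodule.smul_mem _ _ (Submodule.pow_mem_pow _ (ell_mem_Msp n a x τ i j0 (hi0 i)) _)
    · exact Submodule.zero_mem _
  have hreg := regSplit_of (Msp n a x τ) (Msp_homog n a x τ) (Msp_indep n a x τ hli) g hgm hgne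
  refine ⟨defo n d x cc w t + ∑ i : Fin (n + 1),
    if P i = 0 then C t * ell n x t j0 i ^ (d + 1) else 0, ?_, ?_, Set.range g, ?_, hreg.2⟩
  · refine (defo_homog n d x cc w t).add (IsHomogeneous.sum _ _ _ fun i _ => ?_)
    split_ifs
    · apply IsHomogeneous.C_mul
      simpa using (ell_homog n x t j0 i).pow (d + 1)
    · exact isHomogeneous_zero _ _ _
  · rw [map_add, map_defo _ he, ht0, defo_zero n d a ha x cc hcc w hw, ← hfe, map_sum,
      Finset.sum_eq_zero, add_zero]
    intro i _
    split_ifs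
    · rw [map_mul, map_C, ht0, C_0, zero_mul]
    · exact map_zero _
  · have hm : map φ (defo n d x cc w t + ∑ i : Fin (n + 1),
        if P i = 0 then C t * ell n x t j0 i ^ (d + 1) else 0) = ∑ i, g i := by
      simp only [hg]
      rw [map_add, map_defo φ hφK, map_sum, Finset.sum_add_distrib, hP0, ← hτd]
      congr 1
      refine Finset.sum_congr rfl fun i _ => ?_
      split_ifs
      · rw [map_mul, map_C, map_pow, map_ell φ hφK, ← hτd]
      · exact map_zero _
    rw [hm]
    exact hreg.1

/-- Theorem 4.5. Let `d ≥ 3` and `f ∈ ℛ_d`. If `M_f` contains a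
nonzero nilpotent matrix `A` of index `n + 1` (so `n = index(A) − 1 ≥ 1`), then `f` is a
specialization (at `t = 0`) of some `f_t ∈ ℛ_d ⊗_K K[t_1,…,t_n]` that splits regularly
`n` times over `K(t_1,…,t_n)`. -/
theorem onematrix_degenerate_splitting {K : Type*} [Field K] [CharZero K] {r d : ℕ}
    (hd : 3 ≤ d) (f : MvPolynomial (Fin r) K) (hf : f.IsHomogeneous d)
    (A : Matrix (Fin r) (Fin r) K) (hA : A ∈ Mf f) {n : ℕ} (hn : 1 ≤ n)
    (hA1 : A ^ (n + 1) = 0) (hA2 : A ^ n ≠ 0) :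
    ∃ ft : MvPolynomial (Fin r) (MvPolynomial (Fin n) K),
      ft.IsHomogeneous d ∧
      MvPolynomial.map (MvPolynomial.eval (0 : Fin n → K)) ft = f ∧
      ∃ G : Set (MvPolynomial (Fin r) (FractionRing (MvPolynomial (Fin n) K))),
        IsRegSplit d (MvPolynomial.map (algebraMap (MvPolynomial (Fin n) K)
          (FractionRing (MvPolynomial (Fin n) K))) ft) G ∧ G.ncard = n + 1 := by
  obtain ⟨d, rfl⟩ : ∃ d', d = d' + 1 := ⟨d - 1, by omega⟩
  have hφi : Function.Injective (algebraMap (MvPolynomial (Fin n) K)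
      (FractionRing (MvPolynomial (Fin n) K))) := IsFractionRing.injective _ _
  have : CharZero (FractionRing (MvPolynomial (Fin n) K)) :=
    charZero_of_injective_algebraMap hφi
  refine core f hf A hA hA1 hA2 _ hφi (IsScalarTower.algebraMap_eq _ _ _).symm _ ?_
    (X ⟨0, hn⟩) (X_ne_zero _) (by simp)
  ext y
  simp

end Kleppe
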